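/- For each fixed integer j ≥ 1 there exists a constant C_j > 0 such that for all integers n ≥ j: |λ_{n,j} − (α_j^4/(n+1)^4 − 4α_j^4/(n+1)^5)| ≤ C_j/(n+1)^6. -/

import Mathlib

open Real Set Filter Topology

/-- The symbol `g(x) = (2 sin(x/2))^4`. -/
noncomputable def g (x : ℝ) : ℝ := (2 * Real.sin (x / 2)) ^ 4

/-- The `n × n` pentadiagonal Toeplitz matrix generated by `g`. -/
noncomputable def T (n : ℕ) : Matrix (Fin n) (Fin n) ℝ :=
  Matrix.of fun j k =>
    if ((j : ℤ) - (k : ℤ)) = 0 then 6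
    else if ((j : ℤ) - (k : ℤ)) = 1 ∨ ((j : ℤ) - (k : ℤ)) = -1 then -4
    else if ((j : ℤ) - (k : ℤ)) = 2 ∨ ((j : ℤ) - (k : ℤ)) = -2 then 1
    else 0

/-! ### Eigenvectors of the pentadiagonal matrix -/

theorem sum_fin_ite_sub_eq {n : ℕ} {u : ℤ → ℝ} (h₁ : u (-1) = 0) (h₂ : u (-2) = 0)
    (h₃ : u n = 0) (h₄ : u (n + 1) = 0) (j d : ℤ) (hlo : -2 ≤ j - d) (hhi : j - d ≤ n + 1) :
    ∑ k : Fin n, (if j - ((k : ℕ) : ℤ) = d then u ((k : ℕ) : ℤ) else 0) = u (j - d) := by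
  by_cases hr : 0 ≤ j - d ∧ j - d < n
  · obtain ⟨m, hm⟩ := Int.eq_ofNat_of_zero_le hr.1
    have hmn : m < n := by omega
    rw [Finset.sum_eq_single (⟨m, hmn⟩ : Fin n)]
    · rw [if_pos (by simp only []; omega), hm]
    · intro k _ hk
      have : (k : ℕ) ≠ m := fun h => hk (Fin.ext h)
      rw [if_neg (by omega)]
    · simp
  · have hz : u (j - d) = 0 := by
      have : j - d = -2 ∨ j - d = -1 ∨ j - d = n ∨ j - d = n + 1 := by omega
      rcases this with h | h | h | h <;> rw [h] <;> assumption
    rw [hz]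
    refine Finset.sum_eq_zero fun k _ => ?_
    have := k.isLt
    rw [if_neg (by omega)]

theorem T_mulVec_apply {n : ℕ} {u : ℤ → ℝ} (h₁ : u (-1) = 0) (h₂ : u (-2) = 0)
    (h₃ : u n = 0) (h₄ : u (n + 1) = 0) (j : Fin n) :
    (T n).mulVec (fun k : Fin n => u ((k : ℕ) : ℤ)) j =
      u ((j : ℕ) + 2) - 4 * u ((j : ℕ) + 1) + 6 * u (j : ℕ) - 4 * u ((j : ℕ) - 1)
        + u ((j : ℕ) - 2) := by
  have hj := j.isLt
  have key := fun d h h' => sum_fin_ite_sub_eq h₁ h₂ h₃ h₄ ((j : ℕ) : ℤ) d h h'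
  have e0 := key 0 (by omega) (by omega)
  have e1 := key 1 (by omega) (by omega)
  have e2 := key 2 (by omega) (by omega)
  have e3 := key (-1) (by omega) (by omega)
  have e4 := key (-2) (by omega) (by omega)
  simp only [sub_neg_eq_add, sub_zero] at e0 e3 e4
  rw [← e0, ← e1, ← e2, ← e3, ← e4]
  simp only [Matrix.mulVec, dotProduct, Finset.mul_sum, ← Finset.sum_add_distrib,
    ← Finset.sum_sub_distrib]
  refine Finset.sum_congr rfl fun k _ => ?_
  simp only [T, Matrix.of_apply]
  generalize ((j : ℕ) : ℤ) - ((k : ℕ) : ℤ) = m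
  split_ifs <;> first | omega | ring

theorem mem_spectrum_of_mulVec_eq {n : ℕ} {A : Matrix (Fin n) (Fin n) ℝ} {μ : ℝ}
    {v : Fin n → ℝ} (hv : v ≠ 0) (h : A.mulVec v = μ • v) : μ ∈ spectrum ℝ A := by
  rw [← Matrix.spectrum_toLin', ← Module.End.hasEigenvalue_iff_mem_spectrum]
  refine Module.End.hasEigenvalue_of_hasEigenvector (x := v)
    ⟨Module.End.mem_eigenspace_iff.2 ?_, hv⟩
  rw [Matrix.toLin'_apply, h]

/-- Two sequences of common parity about the centre of `{0, …, n - 1}`, one an eigenfunction of the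
second difference for `-s` and the other for `s`, combine into an eigenvector of `T n` as soon as
they are proportional on `{n, n + 1}`. -/
theorem sq_mem_spectrum_T {n : ℕ} (hn : 1 ≤ n) {C D : ℤ → ℝ} {s ε : ℝ} (hs : s ≠ 0)
    (hC : ∀ k, C (k + 1) + C (k - 1) = (2 - s) * C k)
    (hD : ∀ k, D (k + 1) + D (k - 1) = (2 + s) * D k)
    (hCε : ∀ k, C (n - 1 - k) = ε * C k) (hDε : ∀ k, D (n - 1 - k) = ε * D k)
    (hdet : C n * D (n + 1) = C (n + 1) * D n) (hDn : D n ≠ 0)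
    (hC0 : C (n - 1) ≠ 0 ∨ C n ≠ 0) : s ^ 2 ∈ spectrum ℝ (T n) := by
  set u : ℤ → ℝ := fun k => D n * C k - C n * D k with hu
  have huε : ∀ k, u (n - 1 - k) = ε * u k := fun k => by simp only [hu, hCε, hDε]; ring
  have h₃ : u n = 0 := by simp only [hu]; ring
  have h₄ : u (n + 1) = 0 := by simp only [hu]; linarith
  have h₁ : u (-1) = 0 := by
    have := huε n
    rwa [h₃, mul_zero, show (n : ℤ) - 1 - n = -1 by ring] at this
  have h₂ : u (-2) = 0 := by
    have := huε (n + 1)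
    rwa [h₄, mul_zero, show (n : ℤ) - 1 - (n + 1) = -2 by ring] at this
  refine mem_spectrum_of_mulVec_eq (v := fun k : Fin n => u ((k : ℕ) : ℤ)) ?_ ?_
  · intro hv
    have hz : ∀ k : ℤ, -1 ≤ k → k ≤ n + 1 → u k = 0 := by
      intro k hk hk'
      by_cases hr : 0 ≤ k ∧ k < n
      · obtain ⟨m, rfl⟩ := Int.eq_ofNat_of_zero_le hr.1
        exact congrFun hv ⟨m, by omega⟩
      · have : k = -1 ∨ k = n ∨ k = n + 1 := by omega
        rcases this with h | h | h <;> rw [h] <;> assumption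
    have hcz : ∀ k : ℤ, 0 ≤ k → k ≤ n → C k = 0 := by
      intro k hk hk'
      have a := hz k (by omega) (by omega)
      have b := hz (k + 1) (by omega) (by omega)
      have c := hz (k - 1) (by omega) (by omega)
      simp only [hu] at a b c
      have : 2 * s * D n * C k = 0 := by
        linear_combination (2 + s) * a - b - c + D n * hC k - C n * hD k
      have h2 : 2 * s * D n ≠ 0 := mul_ne_zero (mul_ne_zero two_ne_zero hs) hDn
      exact (mul_eq_zero.1 this).resolve_left h2
    rcases hC0 with h | h
    · exact h (hcz _ (by omega) (by omega))
    · exact h (hcz _ (by omega) (by omega))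
  · funext j
    rw [T_mulVec_apply h₁ h₂ h₃ h₄]
    simp only [Pi.smul_apply, smul_eq_mul, hu]
    set k : ℤ := ((j : ℕ) : ℤ)
    have c1 := hC (k + 1)
    have c2 := hC k
    have c3 := hC (k - 1)
    have d1 := hD (k + 1)
    have d2 := hD k
    have d3 := hD (k - 1)
    rw [show k + 1 + 1 = k + 2 by ring, show k + 1 - 1 = k by ring] at c1 d1
    rw [show k - 1 + 1 = k by ring, show k - 1 - 1 = k - 2 by ring] at c3 d3
    linear_combination D n * (c1 + c3 - (2 + s) * c2) - C n * (d1 + d3 - (2 - s) * d2)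

theorem sin_two_mul_pos {t : ℝ} (h0 : 0 < t) (h1 : t < π / 2) : 0 < Real.sin (2 * t) :=
  Real.sin_pos_of_pos_of_lt_pi (by linarith) (by linarith)

theorem mem_spectrum_T_of_symmetric {n : ℕ} (hn : 1 ≤ n) {t b : ℝ} (h0 : 0 < t) (h1 : t < π / 2)
    (hb : Real.sinh b = Real.sin t)
    (h : Real.sin ((n + 2) * t) * (Real.cosh b * Real.cosh ((n + 2) * b)) +
      Real.cos ((n + 2) * t) * (Real.cos t * Real.sinh ((n + 2) * b)) = 0) :
    (2 * Real.sin t) ^ 4 ∈ spectrum ℝ (T n) := by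
  have hst : 0 < Real.sin t := Real.sin_pos_of_pos_of_lt_pi h0 (by linarith)
  have key := sq_mem_spectrum_T (n := n) hn
    (C := fun k => Real.cos ((2 * k - n + 1) * t)) (D := fun k => Real.cosh ((2 * k - n + 1) * b))
    (s := 4 * Real.sin t ^ 2) (ε := 1) (by positivity) ?_ ?_ ?_ ?_ ?_ (Real.cosh_pos _).ne' ?_
  · convert key using 1; ring
  · intro k
    push_cast
    rw [show (2 * ((k : ℝ) + 1) - n + 1) * t = (2 * k - n + 1) * t + 2 * t by ring,
      show (2 * ((k : ℝ) - 1) - n + 1) * t = (2 * k - n + 1) * t - 2 * t by ring,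
      Real.cos_add, Real.cos_sub, Real.cos_two_mul]
    linear_combination 4 * Real.cos ((2 * k - n + 1) * t) * Real.sin_sq_add_cos_sq t
  · intro k
    push_cast
    rw [show (2 * ((k : ℝ) + 1) - n + 1) * b = (2 * k - n + 1) * b + 2 * b by ring,
      show (2 * ((k : ℝ) - 1) - n + 1) * b = (2 * k - n + 1) * b - 2 * b by ring,
      Real.cosh_add, Real.cosh_sub, Real.cosh_two_mul, ← hb]
    linear_combination 2 * Real.cosh ((2 * k - n + 1) * b) * Real.cosh_sq b
  · intro k
    push_cast
    rw [one_mul, ← Real.cos_neg]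
    ring_nf
  · intro k
    push_cast
    rw [one_mul, ← Real.cosh_neg]
    ring_nf
  · push_cast
    rw [show (2 * (n : ℝ) - n + 1) * t = (n + 2) * t - t by ring,
      show (2 * (n : ℝ) - n + 1) * b = (n + 2) * b - b by ring,
      show (2 * ((n : ℝ) + 1) - n + 1) * t = (n + 2) * t + t by ring,
      show (2 * ((n : ℝ) + 1) - n + 1) * b = (n + 2) * b + b by ring,
      Real.cos_sub, Real.cos_add, Real.cosh_sub, Real.cosh_add]
    rw [hb]
    linear_combination 2 * Real.sin t * h
  · by_contra! hc
    obtain ⟨ha, hb'⟩ := hc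
    push_cast at ha hb'
    rw [show (2 * (n : ℝ) - n + 1) * t = (2 * (n - 1) - n + 1) * t + 2 * t by ring, Real.cos_add,
      ha] at hb'
    have h3 := (sin_two_mul_pos h0 h1).ne'
    have h4 : Real.sin ((2 * ((n : ℝ) - 1) - n + 1) * t) = 0 := by
      have : Real.sin ((2 * ((n : ℝ) - 1) - n + 1) * t) * Real.sin (2 * t) = 0 := by linarith
      exact (mul_eq_zero.1 this).resolve_right h3
    have := Real.sin_sq_add_cos_sq ((2 * ((n : ℝ) - 1) - n + 1) * t)
    rw [ha, h4] at this
    norm_num at this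

theorem mem_spectrum_T_of_antisymmetric {n : ℕ} (hn : 1 ≤ n) {t b : ℝ} (h0 : 0 < t)
    (h1 : t < π / 2) (hb : Real.sinh b = Real.sin t)
    (h : Real.sin ((n + 2) * t) * (Real.cos t * Real.cosh ((n + 2) * b)) -
      Real.cos ((n + 2) * t) * (Real.cosh b * Real.sinh ((n + 2) * b)) = 0) :
    (2 * Real.sin t) ^ 4 ∈ spectrum ℝ (T n) := by
  have hst : 0 < Real.sin t := Real.sin_pos_of_pos_of_lt_pi h0 (by linarith)
  have hb0 : 0 < b := Real.sinh_pos_iff.1 (hb ▸ hst)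
  have key := sq_mem_spectrum_T (n := n) hn
    (C := fun k => Real.sin ((2 * k - n + 1) * t)) (D := fun k => Real.sinh ((2 * k - n + 1) * b))
    (s := 4 * Real.sin t ^ 2) (ε := -1) (by positivity) ?_ ?_ ?_ ?_ ?_ ?_ ?_
  · convert key using 1; ring
  · intro k
    push_cast
    rw [show (2 * ((k : ℝ) + 1) - n + 1) * t = (2 * k - n + 1) * t + 2 * t by ring,
      show (2 * ((k : ℝ) - 1) - n + 1) * t = (2 * k - n + 1) * t - 2 * t by ring,
      Real.sin_add, Real.sin_sub, Real.cos_two_mul]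
    linear_combination 4 * Real.sin ((2 * k - n + 1) * t) * Real.sin_sq_add_cos_sq t
  · intro k
    push_cast
    rw [show (2 * ((k : ℝ) + 1) - n + 1) * b = (2 * k - n + 1) * b + 2 * b by ring,
      show (2 * ((k : ℝ) - 1) - n + 1) * b = (2 * k - n + 1) * b - 2 * b by ring,
      Real.sinh_add, Real.sinh_sub, Real.cosh_two_mul, ← hb]
    linear_combination 2 * Real.sinh ((2 * k - n + 1) * b) * Real.cosh_sq b
  · intro k
    push_cast
    rw [neg_one_mul, ← Real.sin_neg]
    ring_nf
  · intro k
    push_cast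
    rw [neg_one_mul, ← Real.sinh_neg]
    ring_nf
  · push_cast
    rw [show (2 * (n : ℝ) - n + 1) * t = (n + 2) * t - t by ring,
      show (2 * (n : ℝ) - n + 1) * b = (n + 2) * b - b by ring,
      show (2 * ((n : ℝ) + 1) - n + 1) * t = (n + 2) * t + t by ring,
      show (2 * ((n : ℝ) + 1) - n + 1) * b = (n + 2) * b + b by ring,
      Real.sin_sub, Real.sin_add, Real.sinh_sub, Real.sinh_add]
    rw [hb]
    linear_combination 2 * Real.sin t * h
  · refine (Real.sinh_pos_iff.2 (mul_pos ?_ hb0)).ne'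
    push_cast
    have : (0 : ℝ) ≤ n := n.cast_nonneg
    linarith
  · by_contra! hc
    obtain ⟨ha, hb'⟩ := hc
    push_cast at ha hb'
    rw [show (2 * (n : ℝ) - n + 1) * t = (2 * (n - 1) - n + 1) * t + 2 * t by ring, Real.sin_add,
      ha] at hb'
    have h3 := (sin_two_mul_pos h0 h1).ne'
    have h4 : Real.cos ((2 * ((n : ℝ) - 1) - n + 1) * t) = 0 := by
      have : Real.cos ((2 * ((n : ℝ) - 1) - n + 1) * t) * Real.sin (2 * t) = 0 := by linarith
      exact (mul_eq_zero.1 this).resolve_right h3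
    have := Real.sin_sq_add_cos_sq ((2 * ((n : ℝ) - 1) - n + 1) * t)
    rw [ha, h4] at this
    norm_num at this

/-! ### Existence of one eigenvalue in each of `n` disjoint intervals -/

/-- The amplitude factor in the phase equation for the `j`-th eigenvalue. -/
noncomputable def phaseFactor (j : ℕ) (t : ℝ) : ℝ :=
  if Even j then Real.cosh (Real.arsinh (Real.sin t)) / Real.cos t
  else Real.cos t / Real.cosh (Real.arsinh (Real.sin t))

/-- The multiple of `π` nearest to the interval `(jπ/2, (j+1)π/2)`. -/
noncomputable def phaseCenter (j : ℕ) : ℝ := ((j + 1) / 2 : ℕ) * Real.pi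

theorem phaseCenter_of_even {j : ℕ} (hj : Even j) : phaseCenter j = j * (Real.pi / 2) := by
  obtain ⟨k, rfl⟩ := hj
  rw [phaseCenter, show (k + k + 1) / 2 = k by omega]
  push_cast
  ring

theorem phaseCenter_of_odd {j : ℕ} (hj : Odd j) :
    phaseCenter j = (j + 1) * (Real.pi / 2) := by
  obtain ⟨k, rfl⟩ := hj
  rw [phaseCenter, show (2 * k + 1 + 1) / 2 = k + 1 by omega]
  push_cast
  ring

theorem phaseFactor_pos (j : ℕ) {t : ℝ} (h0 : 0 < t) (h1 : t < π / 2) : 0 < phaseFactor j t := by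
  have hc : 0 < Real.cos t := Real.cos_pos_of_mem_Ioo ⟨by linarith, h1⟩
  have hch := Real.cosh_pos (Real.arsinh (Real.sin t))
  rw [phaseFactor]
  split_ifs <;> positivity

theorem Real.tanh_pos_of_pos {x : ℝ} (hx : 0 < x) : 0 < Real.tanh x := by
  rw [Real.tanh_eq_sinh_div_cosh]
  exact div_pos (Real.sinh_pos_iff.2 hx) (Real.cosh_pos x)

theorem Real.continuous_tanh' : Continuous Real.tanh := by
  simp only [funext Real.tanh_eq_sinh_div_cosh]
  exact Real.continuous_sinh.div Real.continuous_cosh fun x => (Real.cosh_pos x).ne'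

theorem sin_eq_of_phase {j : ℕ} {x v : ℝ} (h : x = phaseCenter j + (-1) ^ j * Real.arctan v) :
    Real.sin x = (-1) ^ j * v * Real.cos x := by
  have htan : Real.tan x = (-1) ^ j * v := by
    rw [h, phaseCenter, add_comm, Real.tan_add_nat_mul_pi]
    rcases neg_one_pow_eq_or ℝ j with h | h <;> simp [h, Real.tan_neg]
  have hcos : Real.cos x ≠ 0 := by
    have : Real.cos ((-1) ^ j * Real.arctan v) ≠ 0 := by
      rcases neg_one_pow_eq_or ℝ j with h | h <;> simp [h, (Real.cos_arctan_pos v).ne']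
    rw [h, phaseCenter, add_comm, Real.cos_add_nat_mul_pi]
    exact mul_ne_zero (pow_ne_zero _ (by norm_num)) this
  rw [← htan, Real.tan_mul_cos hcos]

theorem phase_of_tan_eq {j : ℕ} {x v : ℝ}
    (hx : x ∈ Set.Ioo (j * (π / 2)) ((j + 1) * (π / 2)))
    (h : v = (-1) ^ j * Real.tan x) : x = phaseCenter j + (-1) ^ j * Real.arctan v := by
  have key : ∀ y, -(π / 2) < y → y < π / 2 → x = y + phaseCenter j →
      x = phaseCenter j + (-1) ^ j * Real.arctan v := by
    intro y hy hy' hxy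
    have ht : Real.tan x = Real.tan y := by
      rw [hxy, phaseCenter, Real.tan_add_nat_mul_pi]
    rw [h, ht]
    rcases neg_one_pow_eq_or ℝ j with hs | hs
    · rw [hs, one_mul, one_mul, Real.arctan_tan hy hy', hxy]; ring
    · rw [hs, neg_one_mul, neg_one_mul, Real.arctan_neg, Real.arctan_tan hy hy', hxy]; ring
  rcases Nat.even_or_odd j with hj | hj
  · have hc := phaseCenter_of_even hj
    exact key (x - phaseCenter j) (by linarith [hx.1, Real.pi_pos]) (by linarith [hx.2]) (by ring)
  · have hc := phaseCenter_of_odd hj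
    exact key (x - phaseCenter j) (by linarith [hx.1]) (by linarith [hx.2, Real.pi_pos]) (by ring)

theorem exists_phase {n j : ℕ} (hj : 1 ≤ j) (hjn : j ≤ n) :
    ∃ t ∈ Set.Ioo (j * (π / 2) / (n + 2)) ((j + 1) * (π / 2) / (n + 2)),
      (n + 2) * t = phaseCenter j + (-1) ^ j *
        Real.arctan (phaseFactor j t * Real.tanh ((n + 2) * Real.arsinh (Real.sin t))) := by
  have hN : (0 : ℝ) < n + 2 := by positivity
  have hj1 : (1 : ℝ) ≤ j := by exact_mod_cast hj
  have hjn' : (j : ℝ) ≤ n := by exact_mod_cast hjn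
  have hpi := Real.pi_pos
  set a := j * (π / 2) / (n + 2) with ha
  set b := (j + 1) * (π / 2) / (n + 2) with hb
  have ha0 : 0 < a := by positivity
  have hab : a < b := by rw [ha, hb]; gcongr; linarith
  have hb1 : b < π / 2 := by
    rw [hb, div_lt_iff₀ hN]; nlinarith
  have hNa : (n + 2) * a = j * (π / 2) := by rw [ha]; field_simp
  have hNb : (n + 2) * b = (j + 1) * (π / 2) := by rw [hb]; field_simp
  set w : ℝ → ℝ := fun t =>
    phaseFactor j t * Real.tanh ((n + 2) * Real.arsinh (Real.sin t)) with hw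
  have hcosh : Continuous fun t => Real.cosh (Real.arsinh (Real.sin t)) :=
    Real.continuous_cosh.comp (Real.continuous_arsinh.comp Real.continuous_sin)
  have hwc : ContinuousOn w (Set.Icc a b) := by
    refine ContinuousOn.mul ?_ ?_
    · unfold phaseFactor
      split_ifs
      · refine hcosh.continuousOn.div Real.continuous_cos.continuousOn fun t ht => ?_
        exact (Real.cos_pos_of_mem_Ioo ⟨by linarith [ht.1], by linarith [ht.2]⟩).ne'
      · exact (Real.continuous_cos.div hcosh fun t => (Real.cosh_pos _).ne').continuousOn
    · exact (Real.continuous_tanh'.comp (continuous_const.mul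
        (Real.continuous_arsinh.comp Real.continuous_sin))).continuousOn
  have hwpos : ∀ t ∈ Set.Icc a b, 0 < Real.arctan (w t) := by
    intro t ht
    have h0 : 0 < t := by linarith [ht.1]
    have h1 : t < π / 2 := by linarith [ht.2]
    refine Real.arctan_pos.2 (mul_pos (phaseFactor_pos j h0 h1) (Real.tanh_pos_of_pos ?_))
    exact mul_pos hN (Real.arsinh_pos_iff.2 (Real.sin_pos_of_pos_of_lt_pi h0 (by linarith)))
  set F : ℝ → ℝ := fun t => (n + 2) * t - (phaseCenter j + (-1) ^ j * Real.arctan (w t)) with hF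
  have hFc : ContinuousOn F (Set.Icc a b) :=
    (continuousOn_const.mul continuousOn_id).sub (continuousOn_const.add
      (continuousOn_const.mul (Real.continuous_arctan.comp_continuousOn hwc)))
  have hpa := hwpos a ⟨le_rfl, hab.le⟩
  have hpb := hwpos b ⟨hab.le, le_rfl⟩
  have hla := Real.arctan_lt_pi_div_two (w a)
  have hlb := Real.arctan_lt_pi_div_two (w b)
  have hmem : (0 : ℝ) ∈ Set.Ioo (F a) (F b) := by
    simp only [hF, hNa, hNb]
    rcases Nat.even_or_odd j with h | h
    · rw [phaseCenter_of_even h, h.neg_one_pow]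
      constructor <;> linarith
    · rw [phaseCenter_of_odd h, h.neg_one_pow]
      constructor <;> linarith
  obtain ⟨t, ht, hFt⟩ := intermediate_value_Ioo hab.le hFc hmem
  exact ⟨t, ht, by simpa [hF, sub_eq_zero] using hFt⟩

theorem mem_spectrum_T_of_phase {n j : ℕ} (hn : 1 ≤ n) {t : ℝ} (h0 : 0 < t) (h1 : t < π / 2)
    (h : (n + 2) * t = phaseCenter j + (-1) ^ j *
      Real.arctan (phaseFactor j t * Real.tanh ((n + 2) * Real.arsinh (Real.sin t)))) :
    (2 * Real.sin t) ^ 4 ∈ spectrum ℝ (T n) := by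
  have hsin := sin_eq_of_phase h
  set b := Real.arsinh (Real.sin t) with hb
  have hc : Real.cos t ≠ 0 := (Real.cos_pos_of_mem_Ioo ⟨by linarith, h1⟩).ne'
  have hch := (Real.cosh_pos b).ne'
  have hchN := (Real.cosh_pos ((n + 2) * b)).ne'
  rcases Nat.even_or_odd j with hj | hj
  · refine mem_spectrum_T_of_antisymmetric hn h0 h1 (Real.sinh_arsinh _) ?_
    rw [hsin, phaseFactor, if_pos hj, hj.neg_one_pow, ← hb, Real.tanh_eq_sinh_div_cosh]
    field_simp
    ring
  · refine mem_spectrum_T_of_symmetric hn h0 h1 (Real.sinh_arsinh _) ?_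
    rw [hsin, phaseFactor, if_neg (Nat.not_even_iff_odd.2 hj), hj.neg_one_pow, ← hb,
      Real.tanh_eq_sinh_div_cosh]
    field_simp
    ring

/-- Two strictly increasing enumerations by `{1, …, n}` of eigenvalues of an `n × n` matrix
coincide. -/
theorem eq_of_strictMono_mem_spectrum {n : ℕ} {A : Matrix (Fin n) (Fin n) ℝ} {x y : ℕ → ℝ}
    (hx : ∀ j k, 1 ≤ j → j < k → k ≤ n → x j < x k)
    (hy : ∀ j k, 1 ≤ j → j < k → k ≤ n → y j < y k)
    (hxs : ∀ j, 1 ≤ j → j ≤ n → x j ∈ spectrum ℝ A)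
    (hys : ∀ j, 1 ≤ j → j ≤ n → y j ∈ spectrum ℝ A) {j : ℕ} (hj : 1 ≤ j) (hjn : j ≤ n) :
    x j = y j := by
  classical
  set s := A.charpoly.roots.toFinset with hs
  have hmem : ∀ z, z ∈ s ↔ z ∈ spectrum ℝ A := fun z => by
    rw [hs, Multiset.mem_toFinset, Polynomial.mem_roots A.charpoly_monic.ne_zero,
      Matrix.mem_spectrum_iff_isRoot_charpoly]
  have hle : s.card ≤ n := by
    refine (Multiset.toFinset_card_le _).trans ((Polynomial.card_roots' _).trans ?_)
    rw [Matrix.charpoly_natDegree_eq_dim, Fintype.card_fin]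
  have hmono : ∀ z : ℕ → ℝ, (∀ j k, 1 ≤ j → j < k → k ≤ n → z j < z k) →
      StrictMono fun i : Fin n => z (i + 1) := by
    intro z hz i k hik
    exact hz _ _ (by omega) (by simpa using hik) (by omega)
  have hcard : s.card = n := by
    refine le_antisymm hle ?_
    have : (Finset.univ.image fun i : Fin n => x (i + 1)) ⊆ s := by
      intro z hz
      obtain ⟨i, -, rfl⟩ := Finset.mem_image.1 hz
      exact (hmem _).2 (hxs _ (by omega) (by omega))
    have h2 := Finset.card_le_card this
    rwa [Finset.card_image_of_injective _ (hmono x hx).injective, Finset.card_univ,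
      Fintype.card_fin] at h2
  have e1 := Finset.orderEmbOfFin_unique hcard
    (fun i => (hmem _).2 (hxs (i + 1) (by omega) (by omega))) (hmono x hx)
  have e2 := Finset.orderEmbOfFin_unique hcard
    (fun i => (hmem _).2 (hys (i + 1) (by omega) (by omega))) (hmono y hy)
  have := congrFun (e1.trans e2.symm) ⟨j - 1, by omega⟩
  simpa [Nat.sub_add_cancel hj] using this

/-- The `j`-th eigenvalue of `T n`, in terms of the solution of the phase equation. -/
theorem exists_phase_of_spectrum {n : ℕ} {x : ℕ → ℝ}
    (hx : ∀ j k, 1 ≤ j → j < k → k ≤ n → x j < x k)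
    (hxs : ∀ j, 1 ≤ j → j ≤ n → x j ∈ spectrum ℝ (T n)) {j : ℕ} (hj : 1 ≤ j) (hjn : j ≤ n) :
    ∃ t ∈ Set.Ioo (j * (π / 2) / (n + 2)) ((j + 1) * (π / 2) / (n + 2)),
      (n + 2) * t = phaseCenter j + (-1) ^ j *
        Real.arctan (phaseFactor j t * Real.tanh ((n + 2) * Real.arsinh (Real.sin t))) ∧
      x j = (2 * Real.sin t) ^ 4 := by
  have hN : (0 : ℝ) < n + 2 := by positivity
  have hpi := Real.pi_pos
  have hex : ∀ i : ℕ, ∃ t : ℝ, 1 ≤ i → i ≤ n →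
      t ∈ Set.Ioo (i * (π / 2) / (n + 2)) ((i + 1) * (π / 2) / (n + 2)) ∧
      (n + 2) * t = phaseCenter i + (-1) ^ i *
        Real.arctan (phaseFactor i t * Real.tanh ((n + 2) * Real.arsinh (Real.sin t))) := by
    intro i
    by_cases h : 1 ≤ i ∧ i ≤ n
    · obtain ⟨t, ht, ht'⟩ := exists_phase h.1 h.2
      exact ⟨t, fun _ _ => ⟨ht, ht'⟩⟩
    · exact ⟨0, fun h1 h2 => absurd ⟨h1, h2⟩ h⟩
  choose t ht using hex
  have hrange : ∀ i, 1 ≤ i → i ≤ n → 0 < t i ∧ t i < π / 2 := by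
    intro i h1 h2
    obtain ⟨⟨hlo, hhi⟩, -⟩ := ht i h1 h2
    have : (i : ℝ) ≤ n := by exact_mod_cast h2
    refine ⟨lt_of_le_of_lt (by positivity) hlo, hhi.trans ?_⟩
    rw [div_lt_iff₀ hN]
    nlinarith
  refine ⟨t j, (ht j hj hjn).1, (ht j hj hjn).2, ?_⟩
  refine eq_of_strictMono_mem_spectrum (y := fun i => (2 * Real.sin (t i)) ^ 4) hx ?_ hxs ?_ hj hjn
  · intro i k hi hik hk
    have hki := hrange k (by omega) hk
    have hii := hrange i hi (by omega)
    have hlt : t i < t k := by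
      refine (ht i hi (by omega)).1.2.trans_le (le_trans ?_ (ht k (by omega) hk).1.1.le)
      have : (i : ℝ) + 1 ≤ k := by exact_mod_cast hik
      gcongr
    have hs : Real.sin (t i) < Real.sin (t k) :=
      Real.sin_lt_sin_of_lt_of_le_pi_div_two (by linarith) hki.2.le hlt
    have hs0 := Real.sin_pos_of_pos_of_lt_pi hii.1 (by linarith)
    gcongr
  · intro i h1 h2
    exact mem_spectrum_T_of_phase (by omega) (hrange i h1 h2).1 (hrange i h1 h2).2 (ht i h1 h2).2

/-! ### Asymptotics of the phase equation -/

theorem Real.hasDerivAt_tanh' (x : ℝ) : HasDerivAt Real.tanh (1 / Real.cosh x ^ 2) x := by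
  have h := (Real.hasDerivAt_sinh x).div (Real.hasDerivAt_cosh x) (Real.cosh_pos x).ne'
  rw [funext Real.tanh_eq_sinh_div_cosh]
  refine h.congr_deriv ?_
  rw [← sq, ← sq, Real.cosh_sq, add_sub_cancel_left]

theorem Real.abs_arctan_sub_arctan_le (x y : ℝ) :
    |Real.arctan x - Real.arctan y| ≤ |x - y| := by
  have := convex_univ.norm_image_sub_le_of_norm_hasDerivWithin_le (f := Real.arctan)
    (f' := fun z => 1 / (1 + z ^ 2)) (C := 1) (x := y) (y := x)
    (fun z _ => (Real.hasDerivAt_arctan z).hasDerivWithinAt) (fun z _ => ?_) trivial trivial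
  · simpa using this
  · rw [Real.norm_of_nonneg (by positivity), div_le_one (by positivity)]
    nlinarith [sq_nonneg z]

theorem Real.abs_tanh_sub_tanh_le (x y : ℝ) : |Real.tanh x - Real.tanh y| ≤ |x - y| := by
  have := convex_univ.norm_image_sub_le_of_norm_hasDerivWithin_le (f := Real.tanh)
    (f' := fun z => 1 / Real.cosh z ^ 2) (C := 1) (x := y) (y := x)
    (fun z _ => (Real.hasDerivAt_tanh' z).hasDerivWithinAt) (fun z _ => ?_) trivial trivial
  · simpa using this
  · have := Real.one_le_cosh z
    rw [Real.norm_of_nonneg (by positivity), div_le_one (by positivity)]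
    nlinarith

theorem abs_arctan_tanh_sub_le {x y : ℝ} (hx : 1 ≤ x) (hy : 1 ≤ y) :
    |Real.arctan (Real.tanh x) - Real.arctan (Real.tanh y)| ≤ 1 / 2 * |x - y| := by
  refine (convex_Ici (1 : ℝ)).norm_image_sub_le_of_norm_hasDerivWithin_le
    (f := fun z => Real.arctan (Real.tanh z))
    (fun z _ => (Real.hasDerivAt_tanh' z).arctan.hasDerivWithinAt) (fun z hz => ?_) hy hx
  have hc := Real.cosh_pos z
  have hz1 : (1 : ℝ) ≤ z := hz
  have hs : 1 ≤ Real.sinh z := hz1.trans (Real.self_le_sinh_iff.2 (by linarith))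
  have h2 := Real.cosh_sq z
  rw [Real.norm_of_nonneg (by positivity), Real.tanh_eq_sinh_div_cosh]
  have : 1 / (1 + (Real.sinh z / Real.cosh z) ^ 2) * (1 / Real.cosh z ^ 2) =
      1 / (Real.cosh z ^ 2 + Real.sinh z ^ 2) := by
    field_simp
  rw [this]
  refine one_div_le_one_div_of_le two_pos ?_
  nlinarith

theorem Real.abs_tanh_le_one (x : ℝ) : |Real.tanh x| ≤ 1 :=
  abs_le.2 ⟨(Real.neg_one_lt_tanh x).le, (Real.tanh_lt_one x).le⟩

theorem cosh_arsinh_sin_le (t : ℝ) :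
    Real.cosh (Real.arsinh (Real.sin t)) ≤ 1 + t ^ 2 / 2 := by
  rw [Real.cosh_arsinh, Real.sqrt_le_left (by positivity)]
  have : Real.sin t ^ 2 ≤ t ^ 2 := sq_le_sq.2 Real.abs_sin_le_abs
  nlinarith [sq_nonneg (t ^ 2)]

theorem abs_phaseFactor_sub_one_le (j : ℕ) {t : ℝ} (h1 : |t| ≤ 1) :
    |phaseFactor j t - 1| ≤ 2 * t ^ 2 := by
  have ht2 : t ^ 2 ≤ 1 := by rw [← sq_abs]; nlinarith [abs_nonneg t]
  have hc := Real.one_sub_sq_div_two_le_cos (x := t)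
  have hc1 := Real.cos_le_one t
  have hch := cosh_arsinh_sin_le t
  have hch1 := Real.one_le_cosh (Real.arsinh (Real.sin t))
  rw [phaseFactor]
  generalize Real.cosh (Real.arsinh (Real.sin t)) = a at *
  generalize Real.cos t = c at *
  have hcpos : 0 < c := by linarith
  split_ifs
  · rw [div_sub_one hcpos.ne', abs_of_nonneg (div_nonneg (by linarith) hcpos.le),
      div_le_iff₀ hcpos]
    nlinarith
  · rw [abs_sub_comm, one_sub_div (by linarith), abs_of_nonneg (div_nonneg (by linarith)
      (by linarith)), div_le_iff₀ (by linarith)]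
    nlinarith

theorem abs_arsinh_sin_sub_le {t : ℝ} (h0 : 0 < t) (h1 : t ≤ 1) :
    |Real.arsinh (Real.sin t) - t| ≤ t ^ 3 := by
  have hsin := Real.sin_gt_sub_cube h0
  have hsin' := Real.sin_le h0.le
  have hs0 := Real.sin_pos_of_pos_of_lt_pi h0 (by linarith [Real.pi_gt_three])
  have hb0 := Real.arsinh_pos_iff.2 hs0
  have hch := cosh_arsinh_sin_le t
  have hsb : Real.sinh (Real.arsinh (Real.sin t)) = Real.sin t := Real.sinh_arsinh _
  have hle := Real.self_le_sinh_iff.2 hb0.le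
  have htanh := Real.abs_tanh_sub_tanh_le (Real.arsinh (Real.sin t)) 0
  rw [Real.tanh_zero, sub_zero, sub_zero, abs_of_pos hb0, Real.tanh_eq_sinh_div_cosh, hsb] at htanh
  have hchp := Real.cosh_pos (Real.arsinh (Real.sin t))
  rw [hsb] at hle
  have h2 := (div_le_iff₀ hchp).1 ((le_abs_self _).trans htanh)
  generalize Real.cosh (Real.arsinh (Real.sin t)) = a at *
  generalize Real.arsinh (Real.sin t) = b at *
  have h3 : b * a ≤ b * (1 + t ^ 2 / 2) := by gcongr
  have h4 : b * (t ^ 2 / 2) ≤ t * (t ^ 2 / 2) := by gcongr; linarith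
  rw [abs_le]
  constructor <;> nlinarith [pow_pos h0 3]

/-- Stability of the phase equation: a solution `t` of the `N`-th discrete equation is, after
scaling by `N`, close to the solution of the limiting equation. -/
theorem abs_phase_sub_le {j : ℕ} {N K t x : ℝ} (hN : 0 < N) (h0 : 0 < t) (h1 : t ≤ 1)
    (hK : N * t ≤ K) (hNt : 1 ≤ N * t) (hx : 1 ≤ x)
    (ht : N * t = phaseCenter j + (-1) ^ j *
      Real.arctan (phaseFactor j t * Real.tanh (N * Real.arsinh (Real.sin t))))
    (hxe : x = phaseCenter j + (-1) ^ j * Real.arctan (Real.tanh x)) :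
    |N * t - x| ≤ 2 * (2 + K) * t ^ 2 := by
  set y := N * Real.arsinh (Real.sin t) with hy
  set r := phaseFactor j t with hr
  have e : |N * t - x| = |Real.arctan (r * Real.tanh y) - Real.arctan (Real.tanh x)| := by
    conv_lhs => rw [ht, hxe]
    rw [add_sub_add_left_eq_sub, ← mul_sub, abs_mul, abs_pow, abs_neg, abs_one, one_pow, one_mul]
  have s1 : |Real.arctan (r * Real.tanh y) - Real.arctan (Real.tanh y)| ≤ 2 * t ^ 2 := by
    refine (Real.abs_arctan_sub_arctan_le _ _).trans ?_
    rw [← sub_one_mul, abs_mul]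
    calc |r - 1| * |Real.tanh y| ≤ (2 * t ^ 2) * 1 := by
          gcongr
          · exact abs_phaseFactor_sub_one_le j (by rwa [abs_of_pos h0])
          · exact Real.abs_tanh_le_one y
      _ = _ := mul_one _
  have s2 : |Real.arctan (Real.tanh y) - Real.arctan (Real.tanh (N * t))| ≤ K * t ^ 2 := by
    refine (Real.abs_arctan_sub_arctan_le _ _).trans
      ((Real.abs_tanh_sub_tanh_le _ _).trans ?_)
    rw [hy, ← mul_sub, abs_mul, abs_of_pos hN]
    calc N * |Real.arsinh (Real.sin t) - t| ≤ N * t ^ 3 := by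
          gcongr; exact abs_arsinh_sin_sub_le h0 h1
      _ = N * t * t ^ 2 := by ring
      _ ≤ _ := by gcongr
  have s3 := abs_arctan_tanh_sub_le hNt hx
  have t1 := abs_sub_le (Real.arctan (r * Real.tanh y)) (Real.arctan (Real.tanh y))
    (Real.arctan (Real.tanh x))
  have t2 := abs_sub_le (Real.arctan (Real.tanh y)) (Real.arctan (Real.tanh (N * t)))
    (Real.arctan (Real.tanh x))
  linarith

theorem abs_pow_four_sub_le {a b K : ℝ} (ha : |a| ≤ K) (hb : |b| ≤ K) :
    |a ^ 4 - b ^ 4| ≤ 4 * K ^ 3 * |a - b| := by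
  have hK : 0 ≤ K := (abs_nonneg a).trans ha
  rw [show a ^ 4 - b ^ 4 = (a ^ 3 + a ^ 2 * b + a * b ^ 2 + b ^ 3) * (a - b) by ring, abs_mul]
  gcongr
  refine (abs_add_le _ _).trans ?_
  have h3 := abs_add_three (a ^ 3) (a ^ 2 * b) (a * b ^ 2)
  simp only [abs_mul, abs_pow] at h3 ⊢
  have e1 : |a| ^ 3 ≤ K ^ 3 := by gcongr
  have e2 : |a| ^ 2 * |b| ≤ K ^ 2 * K := by gcongr
  have e3 : |a| * |b| ^ 2 ≤ K * K ^ 2 := by gcongr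
  have e4 : |b| ^ 3 ≤ K ^ 3 := by gcongr
  nlinarith

theorem abs_inv_pow_four_expansion_le {M : ℝ} (hM : 0 < M) :
    |1 / (M + 1) ^ 4 - (1 / M ^ 4 - 4 / M ^ 5)| ≤ 10 / M ^ 6 := by
  have e : 1 / (M + 1) ^ 4 - (1 / M ^ 4 - 4 / M ^ 5) =
      (10 * M ^ 3 + 20 * M ^ 2 + 15 * M + 4) / (M ^ 5 * (M + 1) ^ 4) := by
    field_simp
    ring
  rw [e, abs_of_nonneg (by positivity), div_le_div_iff₀ (by positivity) (by positivity)]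
  have : 0 ≤ M ^ 5 * (10 * (M + 1) ^ 4 - M * (10 * M ^ 3 + 20 * M ^ 2 + 15 * M + 4)) := by
    refine mul_nonneg (by positivity) ?_
    have : 10 * (M + 1) ^ 4 - M * (10 * M ^ 3 + 20 * M ^ 2 + 15 * M + 4) =
      20 * M ^ 3 + 45 * M ^ 2 + 36 * M + 10 := by ring
    rw [this]
    positivity
  nlinarith

theorem exists_bound_of_eventually_bound {f : ℕ → ℝ} {C : ℝ} {n₀ p : ℕ}
    (h : ∀ n, n₀ ≤ n → |f n| ≤ C / ((n : ℝ) + 1) ^ p) :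
    ∃ C' : ℝ, 0 < C' ∧ ∀ n, |f n| ≤ C' / ((n : ℝ) + 1) ^ p := by
  have hnn : ∀ m : ℕ, 0 ≤ |f m| * ((m : ℝ) + 1) ^ p := fun m => by positivity
  have hsum := Finset.sum_nonneg fun m (_ : m ∈ Finset.range n₀) => hnn m
  refine ⟨|C| + 1 + ∑ m ∈ Finset.range n₀, |f m| * ((m : ℝ) + 1) ^ p, by positivity, fun n => ?_⟩
  have hp : (0 : ℝ) < ((n : ℝ) + 1) ^ p := by positivity
  rcases le_or_gt n₀ n with hn | hn
  · refine (h n hn).trans ?_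
    gcongr
    linarith [le_abs_self C]
  · rw [le_div_iff₀ hp]
    have := Finset.single_le_sum (fun m _ => hnn m) (Finset.mem_range.2 hn)
    linarith [abs_nonneg C]

/-- The eigenvalue `(2 sin t)^4` compared with its two-term expansion. -/
theorem abs_eigenvalue_sub_expansion_le {K M t x : ℝ} (hM : 0 < M) (hK0 : 0 < K) (h0 : 0 < t)
    (h1 : t ≤ 1) (hK : (M + 1) * t ≤ K) (hx0 : 0 < x) (hxK : x ≤ K)
    (h : |(M + 1) * t - x| ≤ 2 * (2 + K) * t ^ 2) :
    |(2 * Real.sin t) ^ 4 - ((2 * x) ^ 4 / M ^ 4 - 4 * (2 * x) ^ 4 / M ^ 5)| ≤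
      (16 * K ^ 6 + 128 * K ^ 5 * (2 + K) + 160 * K ^ 4) / M ^ 6 := by
  have htM : t ≤ K / M := by
    rw [le_div_iff₀ hM]; nlinarith
  have hN : 0 < M + 1 := by linarith
  have hsin := Real.sin_gt_sub_cube h0
  have hsin' := Real.sin_le h0.le
  have hs0 := Real.sin_pos_of_pos_of_lt_pi h0 (by linarith [Real.pi_gt_three])
  have d1 : |(2 * Real.sin t) ^ 4 - (2 * t) ^ 4| ≤ 16 * (K / M) ^ 6 := by
    have a := abs_pow_four_sub_le (a := Real.sin t) (b := t) (K := t)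
      (by rwa [abs_of_pos hs0]) (by rw [abs_of_pos h0])
    have b : |Real.sin t - t| ≤ t ^ 3 / 4 := by
      rw [abs_le]; constructor <;> nlinarith [pow_pos h0 3]
    have c : 4 * t ^ 3 * |Real.sin t - t| ≤ 4 * t ^ 3 * (t ^ 3 / 4) := by gcongr
    have d : t ^ 6 ≤ (K / M) ^ 6 := by gcongr
    rw [mul_pow, mul_pow, ← mul_sub, abs_mul, abs_of_pos (by norm_num)]
    nlinarith
  have d2 : |(2 * t) ^ 4 - (2 * x) ^ 4 / (M + 1) ^ 4| ≤ 128 * K ^ 3 * (2 + K) * K ^ 2 / M ^ 6 := by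
    have a := abs_pow_four_sub_le (a := (M + 1) * t) (b := x) (K := K)
      (by rwa [abs_of_pos (by positivity)]) (by rwa [abs_of_pos hx0])
    have e : (2 * t) ^ 4 - (2 * x) ^ 4 / (M + 1) ^ 4 =
        16 * (((M + 1) * t) ^ 4 - x ^ 4) / (M + 1) ^ 4 := by
      field_simp
      ring
    rw [e, abs_div, abs_mul, abs_of_pos (show (0 : ℝ) < 16 by norm_num),
      abs_of_pos (show 0 < (M + 1) ^ 4 by positivity)]
    calc 16 * |((M + 1) * t) ^ 4 - x ^ 4| / (M + 1) ^ 4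
        ≤ 16 * (4 * K ^ 3 * (2 * (2 + K) * (K / M) ^ 2)) / M ^ 4 := by
          gcongr
          · exact a.trans (by gcongr; exact h.trans (by gcongr))
          · linarith
      _ = _ := by field_simp; ring
  have d3 : |(2 * x) ^ 4 / (M + 1) ^ 4 - ((2 * x) ^ 4 / M ^ 4 - 4 * (2 * x) ^ 4 / M ^ 5)| ≤
      (2 * K) ^ 4 * (10 / M ^ 6) := by
    have e : (2 * x) ^ 4 / (M + 1) ^ 4 - ((2 * x) ^ 4 / M ^ 4 - 4 * (2 * x) ^ 4 / M ^ 5) =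
        (2 * x) ^ 4 * (1 / (M + 1) ^ 4 - (1 / M ^ 4 - 4 / M ^ 5)) := by ring
    rw [e, abs_mul, abs_of_pos (show 0 < (2 * x) ^ 4 by positivity)]
    gcongr
    exact abs_inv_pow_four_expansion_le hM
  have t1 := abs_sub_le ((2 * Real.sin t) ^ 4) ((2 * t) ^ 4)
    ((2 * x) ^ 4 / M ^ 4 - 4 * (2 * x) ^ 4 / M ^ 5)
  have t2 := abs_sub_le ((2 * t) ^ 4) ((2 * x) ^ 4 / (M + 1) ^ 4)
    ((2 * x) ^ 4 / M ^ 4 - 4 * (2 * x) ^ 4 / M ^ 5)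
  have e : (16 * K ^ 6 + 128 * K ^ 5 * (2 + K) + 160 * K ^ 4) / M ^ 6 =
      16 * (K / M) ^ 6 + 128 * K ^ 3 * (2 + K) * K ^ 2 / M ^ 6 + (2 * K) ^ 4 * (10 / M ^ 6) := by
    field_simp
    ring
  rw [e]
  linarith

theorem stmt19 (lam : ℕ → ℕ → ℝ)
    (hmono : ∀ n, 1 ≤ n → ∀ j k, 1 ≤ j → j < k → k ≤ n → lam n j < lam n k)
    (hspec : ∀ n, 1 ≤ n → ∀ j, 1 ≤ j → j ≤ n → lam n j ∈ spectrum ℝ (T n))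
    (alpha : ℕ → ℝ)
    (halpha : ∀ i : ℕ, 1 ≤ i →
      alpha i ∈ Set.Ioo ((i : ℝ) * Real.pi) (((i : ℝ) + 1) * Real.pi) ∧
      Real.tanh (alpha i / 2) = (-1 : ℝ) ^ i * Real.tan (alpha i / 2))
    (j : ℕ) (hj : 1 ≤ j) :
    ∃ C : ℝ, 0 < C ∧ ∀ n : ℕ, j ≤ n →
      |lam n j - ((alpha j) ^ 4 / ((n : ℝ) + 1) ^ 4
          - 4 * (alpha j) ^ 4 / ((n : ℝ) + 1) ^ 5)|
        ≤ C / ((n : ℝ) + 1) ^ 6 := by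
  obtain ⟨halj, htan⟩ := halpha j hj
  have hpi := Real.pi_gt_three
  have hj1 : (1 : ℝ) ≤ j := by exact_mod_cast hj
  set x := alpha j / 2 with hx
  have hxmem : x ∈ Set.Ioo (j * (π / 2)) ((j + 1) * (π / 2)) :=
    ⟨by linarith [halj.1], by linarith [halj.2]⟩
  have hxe := phase_of_tan_eq hxmem htan
  have hjpi : 1 ≤ j * (π / 2) := by nlinarith
  set K := ((j : ℝ) + 1) * (π / 2) with hKdef
  have hK0 : 0 < K := by positivity
  have hax : alpha j = 2 * x := by rw [hx]; ring
  obtain ⟨n₀, hn₀⟩ := exists_nat_ge K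
  have hlarge : ∀ n : ℕ, max n₀ j ≤ n →
      |lam n j - ((alpha j) ^ 4 / ((n : ℝ) + 1) ^ 4 - 4 * (alpha j) ^ 4 / ((n : ℝ) + 1) ^ 5)| ≤
        (16 * K ^ 6 + 128 * K ^ 5 * (2 + K) + 160 * K ^ 4) / ((n : ℝ) + 1) ^ 6 := by
    intro n hn
    have hjn : j ≤ n := (le_max_right _ _).trans hn
    have hKn : K ≤ n := hn₀.trans (by exact_mod_cast (le_max_left _ _).trans hn)
    have hN : (0 : ℝ) < n + 2 := by positivity
    obtain ⟨t, ⟨hlo, hhi⟩, hph, hlam⟩ :=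
      exists_phase_of_spectrum (hmono n (hj.trans hjn)) (hspec n (hj.trans hjn)) hj hjn
    rw [div_lt_iff₀ hN] at hlo
    rw [lt_div_iff₀ hN] at hhi
    have ht0 : 0 < t := by
      by_contra! hc
      nlinarith
    have ht1 : t ≤ 1 := by
      by_contra! hc
      nlinarith
    have hest := abs_phase_sub_le hN ht0 ht1 (K := K) (by linarith) (by linarith)
      (hjpi.trans hxmem.1.le) hph hxe
    rw [hlam, hax]
    have e : ((n : ℝ) + 1) + 1 = n + 2 := by ring
    exact abs_eigenvalue_sub_expansion_le (by positivity) hK0 ht0 ht1 (by rw [e]; linarith)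
      (by linarith [hxmem.1]) hxmem.2.le (by rwa [e])
  obtain ⟨C, hC, hb⟩ := exists_bound_of_eventually_bound hlarge
  exact ⟨C, hC, fun n _ => hb n⟩
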